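/- arXiv:1110.6590 — 8 statements merged into one kernel-verified Lean document; each statement's English description precedes it below -/
import Mathlib

section
/- In the case b = k, for any two distinct field elements α ≠ β in F = GF(2^k), the intersection of the range of L_α and the range of L_β is the zero subspace; that is, the only vector common to the row spaces of A_α and A_β is the zero vector. -/
/-- In the case `b = k`, for any two distinct field elements `α ≠ β` in
`F = GF(2^k)`, the intersection of the range of `L_α : v ↦ (v, σ(α · σ⁻¹(v)))` and the
range of `L_β` is the zero subspace; i.e. the only vector common to the row spaces of
`A_α` and `A_β` is the zero vector. -/
theorem wozencraft_disjoint_rowspaces (k : ℕ) (hk : 1 ≤ k)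
    (σ : GaloisField 2 k ≃ₗ[ZMod 2] (Fin k → ZMod 2))
    (α β : GaloisField 2 k) (hαβ : α ≠ β) :
    (Set.range fun v : Fin k → ZMod 2 => (v, σ (α * σ.symm v))) ∩
      (Set.range fun v : Fin k → ZMod 2 => (v, σ (β * σ.symm v)))
    = {(0 : (Fin k → ZMod 2) × (Fin k → ZMod 2))} := by
  ext ⟨a, b⟩
  constructor
  · rintro ⟨⟨v, hv⟩, ⟨w, hw⟩⟩
    obtain ⟨hv1, hv2⟩ := Prod.mk.inj hv
    obtain ⟨hw1, hw2⟩ := Prod.mk.inj hw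
    subst hv1
    subst hw1
    have h := σ.injective (hv2.trans hw2.symm)
    have hz : σ.symm w = 0 := by
      by_contra hne
      exact hαβ (mul_right_cancel₀ hne h)
    have hw0 : w = 0 := by simpa using hz
    have hb : b = 0 := by rw [← hv2, hz, mul_zero, map_zero]
    rw [hw0, hb]
    rfl
  · intro h
    rw [Set.mem_singleton_iff] at h
    rw [h]
    exact ⟨⟨0, by simp⟩, ⟨0, by simp⟩⟩
end

section
/- Let y ∈ F_2^{k+b} be a vector of Hamming weight s ≥ 1. Then the number of field elements α ∈ F for which there exists a nonzero vector y' with y' ≤ y coordinatewise and y' in the range of L_α is at most (2^s − 1) · 2^{k−b}, which is strictly less than 2^{k+s−b}. -/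
lemma zmod2_cases (a : ZMod 2) : a = 0 ∨ a = 1 := by
  revert a; decide

/-- The vectors below `y`. -/
def belowSet (k b : ℕ) (y : (Fin k → ZMod 2) × (Fin b → ZMod 2)) :
    Finset ((Fin k → ZMod 2) × (Fin b → ZMod 2)) :=
  Finset.univ.filter fun y' =>
    (∀ i, y'.1 i = 1 → y.1 i = 1) ∧ (∀ i, y'.2 i = 1 → y.2 i = 1)

lemma vec_ext_of_filter {n : ℕ} (u v : Fin n → ZMod 2)
    (h : (Finset.univ.filter fun i => u i = 1) = Finset.univ.filter fun i => v i = 1) :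
    u = v := by
  funext i
  have hi := Finset.ext_iff.mp h i
  simp only [Finset.mem_filter, Finset.mem_univ, true_and] at hi
  rcases zmod2_cases (u i) with hu | hu <;> rcases zmod2_cases (v i) with hv | hv <;>
    simp_all

lemma card_belowSet (k b : ℕ) (y : (Fin k → ZMod 2) × (Fin b → ZMod 2)) :
    (belowSet k b y).card ≤ 2 ^ ((Finset.univ.filter fun i => y.1 i ≠ 0).card
             + (Finset.univ.filter fun i => y.2 i ≠ 0).card) := by
  rw [pow_add, ← Finset.card_powerset, ← Finset.card_powerset, ← Finset.card_product]
  apply Finset.card_le_card_of_injOn (fun y' =>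
    ((Finset.univ.filter fun i => y'.1 i = 1), (Finset.univ.filter fun i => y'.2 i = 1)))
  · intro y' hy'
    have hy' := (Finset.mem_filter.mp (Finset.mem_coe.mp hy')).2
    rw [Finset.mem_coe, Finset.mem_product, Finset.mem_powerset, Finset.mem_powerset]
    constructor
    · intro i hi
      have := hy'.1 i (Finset.mem_filter.mp hi).2
      simp [this]
    · intro i hi
      have := hy'.2 i (Finset.mem_filter.mp hi).2
      simp [this]
  · intro u _ v _ h
    have h := Prod.mk.inj h
    exact Prod.ext (vec_ext_of_filter _ _ h.1) (vec_ext_of_filter _ _ h.2)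

lemma card_fiber (k b : ℕ) (hkb : b ≤ k) [Fintype (GaloisField 2 k)]
    (σ : GaloisField 2 k ≃ₗ[ZMod 2] (Fin k → ZMod 2))
    (v : Fin k → ZMod 2) (hv : v ≠ 0) (w : Fin b → ZMod 2)
    (S : Finset (GaloisField 2 k))
    (hS : ∀ α ∈ S, (fun i : Fin b =>
      σ (α * σ.symm v) ⟨i.val, lt_of_lt_of_le i.isLt hkb⟩) = w) :
    S.card ≤ 2 ^ (k - b) := by
  have hc : (Finset.univ : Finset (Fin (k - b) → ZMod 2)).card = 2 ^ (k - b) := by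
    simp [ZMod.card]
  rw [← hc]
  apply Finset.card_le_card_of_injOn (fun α => fun j : Fin (k - b) =>
    σ (α * σ.symm v) ⟨b + j.val, by omega⟩)
  · intro _ _; simp
  · intro α hα β hβ h
    have hne : σ.symm v ≠ 0 := by simpa using hv
    apply mul_right_cancel₀ hne
    apply σ.injective
    funext i
    by_cases hi : i.val < b
    · exact congrFun ((hS α hα).trans (hS β hβ).symm) ⟨i.val, hi⟩
    · have := congrFun h ⟨i.val - b, by omega⟩
      have e : (⟨b + (i.val - b), by omega⟩ : Fin k) = i := by ext; simp; omega
      simpa only [e] using this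

/-- Let `y ∈ F_2^{k+b}` (represented as a pair in `F_2^k × F_2^b`) have
Hamming weight `s ≥ 1`. Then the number of field elements `α ∈ F = GF(2^k)` for which
there exists a nonzero vector `y' ≤ y` (coordinatewise) in the range of
`L_α : v ↦ (v, π_b(σ(α · σ⁻¹(v))))` is at most `(2^s - 1) · 2^(k-b)`, which is strictly
less than `2^(k+s-b)`. -/
theorem wozencraft_union_bound (k b : ℕ) (hb : 1 ≤ b) (hkb : b ≤ k)
    (σ : GaloisField 2 k ≃ₗ[ZMod 2] (Fin k → ZMod 2))
    (y : (Fin k → ZMod 2) × (Fin b → ZMod 2)) (s : ℕ) (hs : 1 ≤ s)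
    (hwt : s = (Finset.univ.filter fun i => y.1 i ≠ 0).card
             + (Finset.univ.filter fun i => y.2 i ≠ 0).card) :
    Nat.card {α : GaloisField 2 k |
      ∃ y' : (Fin k → ZMod 2) × (Fin b → ZMod 2),
        y' ≠ 0 ∧
        (∀ i, y'.1 i = 1 → y.1 i = 1) ∧ (∀ i, y'.2 i = 1 → y.2 i = 1) ∧
        ∃ v : Fin k → ZMod 2,
          (v, fun i : Fin b => σ (α * σ.symm v) ⟨i.val, lt_of_lt_of_le i.isLt hkb⟩) = y'}
      ≤ (2 ^ s - 1) * 2 ^ (k - b) ∧ (2 ^ s - 1) * 2 ^ (k - b) < 2 ^ (k + s - b) := by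
  classical
  have hpos : 0 < 2 ^ (k - b) := by positivity
  refine ⟨?_, ?_⟩
  · haveI : Finite (GaloisField 2 k) := Finite.of_equiv _ σ.symm.toEquiv
    letI : Fintype (GaloisField 2 k) := Fintype.ofFinite _
    let T : (Fin k → ZMod 2) × (Fin b → ZMod 2) → Finset (GaloisField 2 k) := fun y' =>
      Finset.univ.filter fun α => (fun i : Fin b =>
        σ (α * σ.symm y'.1) ⟨i.val, lt_of_lt_of_le i.isLt hkb⟩) = y'.2
    let D := ((belowSet k b y).erase 0).filter fun y' => y'.1 ≠ 0
    have hD : D.card ≤ 2 ^ s - 1 := by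
      refine (Finset.card_filter_le _ _).trans ?_
      have h0 : (0 : (Fin k → ZMod 2) × (Fin b → ZMod 2)) ∈ belowSet k b y := by
        simp [belowSet]
      rw [Finset.card_erase_of_mem h0, hwt]
      exact Nat.sub_le_sub_right (card_belowSet k b y) 1
    have hU : (D.biUnion T).card ≤ D.card * 2 ^ (k - b) := by
      apply Finset.card_biUnion_le_card_mul
      intro y' hy'
      exact card_fiber k b hkb σ y'.1 (Finset.mem_filter.mp hy').2 y'.2 _
        (fun α hα => (Finset.mem_filter.mp hα).2)
    refine le_trans ?_ (hU.trans (Nat.mul_le_mul_right _ hD))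
    rw [Nat.card_coe_set_eq, ← Set.ncard_coe_finset]
    apply Set.ncard_le_ncard _ (Finset.finite_toSet _)
    rintro α ⟨y', hne, h1, h2, v, rfl⟩
    rw [Finset.mem_coe, Finset.mem_biUnion]
    refine ⟨_, Finset.mem_filter.mpr ⟨Finset.mem_erase.mpr ⟨hne,
      Finset.mem_filter.mpr ⟨Finset.mem_univ _, h1, h2⟩⟩, ?_⟩,
      Finset.mem_filter.mpr ⟨Finset.mem_univ _, rfl⟩⟩
    rintro hv
    apply hne
    have hv : v = 0 := hv
    subst hv
    ext i <;> simp
  · have e : k + s - b = s + (k - b) := by omega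
    rw [e, pow_add]
    exact Nat.mul_lt_mul_of_pos_right (Nat.sub_lt (by positivity) one_pos) hpos
end

section
/- Let ε ∈ (0,1) be a real number and let S ⊆ {1,…,k+b} be a set of coordinates with |S| ≤ (1−ε)b. Then the number of field elements α ∈ F for which the linear map obtained by composing L_α with the projection deleting the coordinates in S (equivalently, the submatrix of A_α on the columns outside S) does NOT have rank k is strictly less than 2^{k−εb}. -/
/-- Let `ε ∈ (0,1)` and let `S ⊆ {1,…,k+b}` be a set of coordinates with
`|S| ≤ (1-ε)·b`. Then the number of field elements `α ∈ F = GF(2^k)` for which the map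
`v ↦ (L_α(v) restricted to the coordinates outside S)` is NOT injective (equivalently,
the submatrix of the Wozencraft matrix `A_α` on the columns outside `S` does not have
rank `k`) is strictly less than `2^(k - εb)`. Here
`L_α(v) = (v, π_b(σ(α · σ⁻¹(v)))) ∈ F_2^{k+b}`. -/
theorem wozencraft_good_matrices (k b : ℕ) (hb : 1 ≤ b) (hkb : b ≤ k)
    (σ : GaloisField 2 k ≃ₗ[ZMod 2] (Fin k → ZMod 2))
    (ε : ℝ) (hε0 : 0 < ε) (hε1 : ε < 1)
    (S : Finset (Fin (k + b))) (hS : (S.card : ℝ) ≤ (1 - ε) * b) :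
    (Nat.card {α : GaloisField 2 k |
        ¬ Function.Injective (fun (v : Fin k → ZMod 2) (i : {i : Fin (k + b) // i ∉ S}) =>
            if h : i.val.val < k then v ⟨i.val.val, h⟩
            else σ (α * σ.symm v) ⟨i.val.val - k, by
              have := i.val.isLt; omega⟩)} : ℝ)
      < (2 : ℝ) ^ ((k : ℝ) - ε * b) := by
  classical
  set B : Set (GaloisField 2 k) := {α : GaloisField 2 k |
        ¬ Function.Injective (fun (v : Fin k → ZMod 2) (i : {i : Fin (k + b) // i ∉ S}) =>
            if h : i.val.val < k then v ⟨i.val.val, h⟩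
            else σ (α * σ.symm v) ⟨i.val.val - k, by
              have := i.val.isLt; omega⟩)} with hB
  let L : GaloisField 2 k → (Fin k → ZMod 2) → Fin (k + b) → ZMod 2 := fun α v i =>
    if h : i.val < k then v ⟨i.val, h⟩
    else σ (α * σ.symm v) ⟨i.val - k, by have := i.isLt; omega⟩
  have hex : ∀ α : B, ∃ v : Fin k → ZMod 2, v ≠ 0 ∧ ∀ i, i ∉ S → L α.1 v i = 0 := by
    rintro ⟨α, hα⟩
    rw [hB, Set.mem_setOf_eq, Function.Injective] at hα
    push Not at hα
    obtain ⟨x, y, hxy, hne⟩ := hα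
    refine ⟨x - y, sub_ne_zero.mpr hne, fun i hi => ?_⟩
    have h := congrFun hxy ⟨i, hi⟩
    simp only [L]
    by_cases hik : i.val < k
    · simp only [hik, dite_true] at h ⊢
      simp [h]
    · simp only [hik, dite_false] at h ⊢
      simp [mul_sub, h]
  choose V hV0 hVS using hex
  let f : B → (S → ZMod 2) × (Fin (k - b) → ZMod 2) := fun α =>
    (fun i => L α.1 (V α) i.1,
     fun j => σ (α.1 * σ.symm (V α)) ⟨b + j.val, by have := j.isLt; omega⟩)
  have hL1 : ∀ α v (i : Fin k), L α v ⟨i.val, by have := i.isLt; omega⟩ = v i := by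
    intro α v i
    simp [L]
  have hL2 : ∀ α v (i : Fin k) (hi : i.val < b),
      L α v ⟨k + i.val, by omega⟩ = σ (α * σ.symm v) i := by
    intro α v i hi
    simp [L]
  have hinj : Function.Injective f := by
    intro α β h
    have h1 : L α.1 (V α) = L β.1 (V β) := by
      funext i
      by_cases hi : i ∈ S
      · exact congrFun (congrArg Prod.fst h) ⟨i, hi⟩
      · rw [hVS α i hi, hVS β i hi]
    have h2 : V α = V β := by
      funext i
      rw [← hL1 α.1 (V α) i, ← hL1 β.1 (V β) i, h1]
    have h3 : σ (α.1 * σ.symm (V α)) = σ (β.1 * σ.symm (V β)) := by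
      funext i
      by_cases hi : i.val < b
      · rw [← hL2 α.1 (V α) i hi, ← hL2 β.1 (V β) i hi, h1]
      · have h4 := congrFun (congrArg Prod.snd h) ⟨i.val - b, by have := i.isLt; omega⟩
        have h5 : b + (i.val - b) = i.val := by omega
        simpa only [f, h5] using h4
    have h4 := σ.injective h3
    rw [h2] at h4
    have h5 : σ.symm (V β) ≠ 0 := by
      simpa using hV0 β
    exact Subtype.ext (mul_right_cancel₀ h5 h4)
  have hnm : ((0, 0) : (S → ZMod 2) × (Fin (k - b) → ZMod 2)) ∉ Set.range f := by
    rintro ⟨α, hα⟩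
    apply hV0 α
    funext i
    rw [← hL1 α.1 (V α) i]
    by_cases hi : (⟨i.val, by have := i.isLt; omega⟩ : Fin (k + b)) ∈ S
    · exact congrFun (congrArg Prod.fst hα) ⟨_, hi⟩
    · exact hVS α _ hi
  haveI : Finite B := Finite.of_injective f hinj
  haveI : Fintype B := Fintype.ofFinite B
  have hcard := Fintype.card_lt_of_injective_of_notMem f hinj hnm
  rw [← Nat.card_eq_fintype_card] at hcard
  simp only [Fintype.card_prod, Fintype.card_fun, ZMod.card, Fintype.card_coe,
    Fintype.card_fin] at hcard
  rw [← pow_add] at hcard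
  have hc : (Nat.card B : ℝ) < (2 : ℝ) ^ (S.card + (k - b)) := by exact_mod_cast hcard
  refine hc.trans_le ?_
  rw [← Real.rpow_natCast]
  apply Real.rpow_le_rpow_of_exponent_le (by norm_num)
  push_cast [Nat.cast_sub hkb]
  linarith
end

section
/- For every ε > 0 and every p ∈ (0,1) there exists N such that for every n ≥ N there exists a two-write binary WOM code of length n whose rate is at least H(p) + 1 − p − ε. -/
/-- A two-write binary WOM code of length `n` over message sets `Ω1`, `Ω2`:
`D1` decodes the first write, the second write only raises cells (coordinatewise `≤`
with `false ≤ true`), and `D2` decodes the second write. -/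
def IsTwoWriteWOM (n : ℕ) {Ω1 Ω2 : Type}
    (E1 : Ω1 → (Fin n → Bool)) (E2 : (Fin n → Bool) → Ω2 → (Fin n → Bool))
    (D1 : (Fin n → Bool) → Ω1) (D2 : (Fin n → Bool) → Ω2) : Prop :=
  (∀ x : Ω1, D1 (E1 x) = x) ∧
  (∀ (x1 : Ω1) (x2 : Ω2), ∀ i, E1 x1 i ≤ E2 (E1 x1) x2 i) ∧
  (∀ (x1 : Ω1) (x2 : Ω2), D2 (E2 (E1 x1) x2) = x2)

/-- The binary entropy function `H(p) = -p log₂ p - (1-p) log₂ (1-p)`. -/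
noncomputable def binEnt (p : ℝ) : ℝ :=
  -(p * Real.logb 2 p) - (1 - p) * Real.logb 2 (1 - p)

/-- Random colouring: if the union bound is below one, some colouring makes every set of the family
rainbow. -/
lemma exists_colouring {X ι : Type} [Fintype X] [DecidableEq X] [Fintype ι] (M a : ℕ) (hM : 0 < M)
    (A : ι → Finset X) (hA : ∀ i, (A i).card = a)
    (h : Fintype.card ι * M * (M - 1) ^ a < M ^ a) :
    ∃ c : X → Fin M, ∀ i y, ∃ x ∈ A i, c x = y := by
  classical
  by_contra hcon
  push Not at hcon
  have haX : ∀ i, a ≤ Fintype.card X := fun i => (hA i) ▸ Finset.card_le_univ _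
  let B : ι × Fin M → Finset (X → Fin M) := fun q =>
    Fintype.piFinset (fun x => if x ∈ A q.1 then Finset.univ.erase q.2 else Finset.univ)
  have hB : ∀ q, (B q).card = (M - 1) ^ a * M ^ (Fintype.card X - a) := by
    intro q
    simp only [B, Fintype.card_piFinset, apply_ite Finset.card]
    rw [Finset.prod_ite]
    simp only [Finset.prod_const, Finset.card_erase_of_mem (Finset.mem_univ _), Finset.card_univ,
      Fintype.card_fin]
    congr 2
    · rw [← hA q.1]; congr 1; ext; simp
    · rw [← hA q.1, ← Finset.card_compl]; congr 1; ext; simp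
  have hcov : (Finset.univ : Finset (X → Fin M)) ⊆ Finset.univ.biUnion B := by
    intro c _
    obtain ⟨i, y, hy⟩ := hcon c
    simp only [Finset.mem_biUnion, Finset.mem_univ, true_and]
    refine ⟨(i, y), ?_⟩
    simp only [B, Fintype.mem_piFinset]
    intro x
    split_ifs with hx
    · simpa using hy x hx
    · simp
  have h1 := (Finset.card_le_card hcov).trans Finset.card_biUnion_le
  simp only [hB] at h1
  simp only [Finset.sum_const, Finset.card_univ, Fintype.card_fun, Fintype.card_fin,
    Fintype.card_prod, smul_eq_mul] at h1
  obtain ⟨i, _, _⟩ := hcon (fun _ => ⟨0, hM⟩)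
  have h2 : M ^ Fintype.card X = M ^ a * M ^ (Fintype.card X - a) := by
    rw [← pow_add, Nat.add_sub_cancel' (haX i)]
  have h3 : 0 < M ^ (Fintype.card X - a) := by positivity
  have h4 := Nat.mul_lt_mul_of_pos_right h h3
  rw [h2] at h1
  rw [mul_assoc] at h4
  omega

lemma union_bound (n k N : ℕ) (hn : 1 ≤ n) (hN : N ≤ 2 ^ n) :
    N * 2 ^ (n - k - (Nat.log 2 n + 2)) * (2 ^ (n - k - (Nat.log 2 n + 2)) - 1) ^ (2 ^ (n - k))
      < (2 ^ (n - k - (Nat.log 2 n + 2))) ^ (2 ^ (n - k)) := by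
  set l := Nat.log 2 n + 2 with hl
  have hl2 : 2 * n ≤ 2 ^ l := by
    have := Nat.lt_pow_succ_log_self (b := 2) (by norm_num) n
    rw [hl, pow_succ]; simp only [Nat.succ_eq_add_one] at this; omega
  by_cases hm : n - k ≤ l
  · have : n - k - l = 0 := by omega
    rw [this]; simp
  · set m := n - k - l with hmdef
    have e : n - k = m + l := by omega
    rw [e]
    have hmn : m ≤ n := by omega
    have key : (N * 2 ^ m * (1 - 1 / 2 ^ m) ^ (2 ^ (m + l)) : ℝ) < 1 := by
      have h1 : (1 - 1 / 2 ^ m : ℝ) ≤ Real.exp (-(1 / 2 ^ m)) := by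
        have := Real.add_one_le_exp (-(1 / 2 ^ m : ℝ)); linarith
      have h0 : (0:ℝ) ≤ 1 - 1 / 2 ^ m := by
        have : (1:ℝ) ≤ 2 ^ m := one_le_pow₀ (by norm_num)
        have := (div_le_one (by positivity)).2 this
        linarith
      have h2 : (1 - 1 / 2 ^ m : ℝ) ^ (2 ^ (m + l)) ≤ Real.exp (-(2 * n)) := by
        refine (pow_le_pow_left₀ h0 h1 _).trans ?_
        rw [← Real.exp_nat_mul]
        apply Real.exp_le_exp.2
        have : ((2 ^ (m + l) : ℕ) : ℝ) * -(1 / 2 ^ m) = - 2 ^ l := by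
          push_cast; rw [pow_add]; field_simp
        rw [this]
        have : (2 * n : ℝ) ≤ 2 ^ l := by exact_mod_cast hl2
        linarith
      have h3 : (N * 2 ^ m : ℝ) ≤ 2 ^ n * 2 ^ n := by
        have : (N : ℝ) ≤ 2 ^ n := by exact_mod_cast hN
        have : (2 : ℝ) ^ m ≤ 2 ^ n := pow_le_pow_right₀ (by norm_num) hmn
        gcongr
      have h4 : (2 ^ n * 2 ^ n : ℝ) < Real.exp (2 * n) := by
        have h5 : (2:ℝ) < Real.exp 1 := by linarith [Real.exp_one_gt_d9]
        have h6 : (2:ℝ) ^ n < Real.exp 1 ^ n := pow_lt_pow_left₀ h5 (by norm_num) (by omega)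
        have h7 : Real.exp (2 * n) = Real.exp 1 ^ n * Real.exp 1 ^ n := by
          rw [← Real.exp_nat_mul, ← Real.exp_add]; congr 1; ring
        rw [h7]
        gcongr
      calc _ ≤ (2 ^ n * 2 ^ n) * Real.exp (-(2 * n)) := by gcongr
        _ < Real.exp (2 * n) * Real.exp (-(2 * n)) := by gcongr
        _ = 1 := by rw [← Real.exp_add]; simp
    have hpos : (0:ℝ) < (2 ^ m) ^ (2 ^ (m + l)) := by positivity
    have h8 := mul_lt_mul_of_pos_right key hpos
    rw [mul_assoc, ← mul_pow, sub_mul, one_mul, one_div, inv_mul_cancel₀ (by positivity)] at h8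
    have : ((N * 2 ^ m * (2 ^ m - 1) ^ 2 ^ (m + l) : ℕ) : ℝ) < (((2 ^ m) ^ 2 ^ (m + l) : ℕ) : ℝ) := by
      rw [Nat.cast_mul, Nat.cast_pow (2 ^ m - 1), Nat.cast_sub Nat.one_le_two_pow]
      push_cast
      linarith
    exact_mod_cast this

lemma exists_code (n k : ℕ) (hn : 1 ≤ n) (hk : k ≤ n) :
    ∃ (Ω1 Ω2 : Type) (i1 : Fintype Ω1) (i2 : Fintype Ω2)
        (E1 : Ω1 → (Fin n → Bool)) (E2 : (Fin n → Bool) → Ω2 → (Fin n → Bool))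
        (D1 : (Fin n → Bool) → Ω1) (D2 : (Fin n → Bool) → Ω2),
        IsTwoWriteWOM n E1 E2 D1 D2 ∧ @Fintype.card Ω1 i1 = n.choose k ∧
        @Fintype.card Ω2 i2 = 2 ^ (n - k - (Nat.log 2 n + 2)) := by
  classical
  let Ω1 := {s : Finset (Fin n) // s.card = k}
  have hc : Fintype.card Ω1 = n.choose k := by simp [Ω1]
  have : Nonempty Ω1 := by
    rw [← Fintype.card_pos_iff, hc]; exact Nat.choose_pos hk
  let A : Ω1 → Finset (Fin n → Bool) := fun s =>
    Fintype.piFinset (fun i => if i ∈ s.1 then {true} else Finset.univ)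
  have hA : ∀ s, (A s).card = 2 ^ (n - k) := by
    intro s
    simp only [A, Fintype.card_piFinset, apply_ite Finset.card]
    rw [Finset.prod_ite]
    simp only [Finset.prod_const, Finset.card_singleton, one_pow, one_mul, Finset.card_univ,
      Fintype.card_bool]
    congr 1
    have := Finset.card_compl s.1
    rw [s.2, Fintype.card_fin] at this
    rw [← this]; congr 1; ext; simp
  have hle : Fintype.card Ω1 ≤ 2 ^ n := by rw [hc]; exact Nat.choose_le_two_pow n k
  obtain ⟨c, hcol⟩ := exists_colouring _ _ (by positivity) A hA (union_bound n k _ hn hle)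
  let E1 : Ω1 → (Fin n → Bool) := fun s i => decide (i ∈ s.1)
  have hinj : Function.Injective E1 := by
    intro s t h
    apply Subtype.ext
    ext i
    have := congrFun h i
    simpa [E1] using this
  have hex : ∀ (s : Ω1) y, ∃ g : Fin n → Bool, (∀ i, E1 s i ≤ g i) ∧ c g = y := by
    intro s y
    obtain ⟨g, hg, hy⟩ := hcol s y
    refine ⟨g, fun i => ?_, hy⟩
    simp only [A, Fintype.mem_piFinset] at hg
    have := hg i
    by_cases hi : i ∈ s.1
    · simp [hi] at this; simp [this]
    · simp [E1, hi]
  refine ⟨Ω1, Fin (2 ^ (n - k - (Nat.log 2 n + 2))), inferInstance, inferInstance, E1,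
    fun f y => if h : ∃ g : Fin n → Bool, (∀ i, f i ≤ g i) ∧ c g = y then h.choose else f,
    Function.invFun E1, c, ⟨Function.leftInverse_invFun hinj, ?_, ?_⟩, hc, by simp⟩
  · intro s y i
    beta_reduce
    rw [dif_pos (hex s y)]
    exact (hex s y).choose_spec.1 i
  · intro s y
    beta_reduce
    rw [dif_pos (hex s y)]
    exact (hex s y).choose_spec.2

lemma gibbs (p : ℝ) (hp0 : 0 < p) (hp1 : p < 1) : binEnt p + 1 - p ≤ Real.logb 2 3 := by
  have hl : 0 < Real.log 2 := Real.log_pos (by norm_num)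
  have hq : 0 < 1 - p := by linarith
  have h1 := Real.log_le_sub_one_of_pos (show 0 < 1 / (3 * p) by positivity)
  have h2 := Real.log_le_sub_one_of_pos (show 0 < 2 / (3 * (1 - p)) by positivity)
  rw [Real.log_div (by norm_num) (by positivity), Real.log_mul (by norm_num) (by positivity)] at h1 h2
  have h3 := mul_le_mul_of_nonneg_left h1 hp0.le
  have h4 := mul_le_mul_of_nonneg_left h2 hq.le
  have e1 : p * (1 / (3 * p) - 1) = 1 / 3 - p := by field_simp
  have e2 : (1 - p) * (2 / (3 * (1 - p)) - 1) = 2 / 3 - (1 - p) := by field_simp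
  rw [e1] at h3
  rw [e2] at h4
  rw [Real.log_one] at h3
  unfold binEnt Real.logb
  rw [le_div_iff₀ hl]
  have : (-(p * (Real.log p / Real.log 2)) - (1 - p) * (Real.log (1 - p) / Real.log 2) + 1 - p)
      * Real.log 2 = -(p * Real.log p) - (1 - p) * Real.log (1 - p) + (1 - p) * Real.log 2 := by
    field_simp
    ring
  rw [this]
  nlinarith

lemma exists_good_k (n : ℕ) : ∃ k ≤ n, 3 ^ n ≤ (n + 1) * (n.choose k * 2 ^ (n - k)) := by
  by_contra hcon
  push Not at hcon
  have h := add_pow 1 2 n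
  have h2 : ∑ m ∈ Finset.range (n + 1), (n + 1) * (n.choose m * 2 ^ (n - m))
      < ∑ m ∈ Finset.range (n + 1), 3 ^ n :=
    Finset.sum_lt_sum_of_nonempty (by simp) (fun m hm => hcon m (by simp at hm; omega))
  rw [← Finset.mul_sum] at h2
  simp only [one_pow, one_mul] at h
  simp only [Finset.sum_const, Finset.card_range, smul_eq_mul] at h2
  have h3 : ∑ m ∈ Finset.range (n + 1), n.choose m * 2 ^ (n - m) = 3 ^ n := by
    rw [show (3:ℕ) = 1 + 2 by norm_num, h]
    exact Finset.sum_congr rfl fun m _ => by simp [mul_comm]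
  rw [h3] at h2
  exact lt_irrefl _ h2

lemma eventually_small (ε : ℝ) (hε : 0 < ε) :
    ∃ N : ℕ, ∀ n : ℕ, N ≤ n → 2 * Real.logb 2 (n + 1) + 2 ≤ ε * n := by
  have hl : 0 < Real.log 2 := Real.log_pos (by norm_num)
  have h := Real.isLittleO_log_id_atTop.bound (show 0 < ε * Real.log 2 / 4 by positivity)
  have ht : Filter.Tendsto (fun n : ℕ => (n : ℝ) + 1) Filter.atTop Filter.atTop :=
    Filter.tendsto_atTop_add_const_right _ _ tendsto_natCast_atTop_atTop
  obtain ⟨N, hN⟩ := Filter.eventually_atTop.1 (ht.eventually h)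
  obtain ⟨K, hK⟩ := exists_nat_ge (4 / ε + 1)
  refine ⟨max N K, fun n hn => ?_⟩
  have h1 := hN n (le_of_max_le_left hn)
  have h2 : (K : ℝ) ≤ n := by exact_mod_cast le_of_max_le_right hn
  have hn0 : (0 : ℝ) ≤ n := Nat.cast_nonneg n
  simp only [id, Real.norm_eq_abs] at h1
  rw [abs_of_nonneg (by positivity : (0:ℝ) ≤ n + 1)] at h1
  have h3 := (le_abs_self _).trans h1
  have h4 : Real.logb 2 (n + 1) ≤ ε / 4 * (n + 1) := by
    unfold Real.logb
    rw [div_le_iff₀ hl]; linarith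
  have h5 : 4 / ε + 1 ≤ n := hK.trans h2
  have h6 : 4 + ε ≤ ε * n := by
    have := mul_le_mul_of_nonneg_left h5 hε.le
    rw [mul_add, mul_div_cancel₀ _ hε.ne'] at this
    linarith
  linarith

/-- For every `ε > 0` and every `p ∈ (0,1)` there exists `N` such that for
every `n ≥ N` there exists a two-write binary WOM code of length `n` whose rate
`(log₂|Ω1| + log₂|Ω2|)/n` is at least `H(p) + 1 - p - ε`. -/
theorem capacity_achieving_two_write_WOM (ε : ℝ) (hε : 0 < ε)
    (p : ℝ) (hp0 : 0 < p) (hp1 : p < 1) :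
    ∃ N : ℕ, ∀ n : ℕ, N ≤ n →
      ∃ (Ω1 Ω2 : Type) (i1 : Fintype Ω1) (i2 : Fintype Ω2)
        (E1 : Ω1 → (Fin n → Bool)) (E2 : (Fin n → Bool) → Ω2 → (Fin n → Bool))
        (D1 : (Fin n → Bool) → Ω1) (D2 : (Fin n → Bool) → Ω2),
        IsTwoWriteWOM n E1 E2 D1 D2 ∧
        (Real.logb 2 (@Fintype.card Ω1 i1) + Real.logb 2 (@Fintype.card Ω2 i2)) / n
          ≥ binEnt p + 1 - p - ε := by
  obtain ⟨N, hN⟩ := eventually_small ε hε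
  refine ⟨max N 1, fun n hn => ?_⟩
  have hn1 : 1 ≤ n := le_of_max_le_right hn
  have hsmall := hN n (le_of_max_le_left hn)
  obtain ⟨k, hk, hbig⟩ := exists_good_k n
  obtain ⟨Ω1, Ω2, i1, i2, E1, E2, D1, D2, hW, hc1, hc2⟩ := exists_code n k hn1 hk
  refine ⟨Ω1, Ω2, i1, i2, E1, E2, D1, D2, hW, ?_⟩
  rw [hc1, hc2]
  have hnpos : (0:ℝ) < n := by exact_mod_cast hn1
  have hg := gibbs p hp0 hp1
  have hchoose : (0:ℝ) < n.choose k := by exact_mod_cast Nat.choose_pos hk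
  have h1 : (3:ℝ) ^ n ≤ (n + 1) * (n.choose k * 2 ^ (n - k)) := by exact_mod_cast hbig
  have h2 := Real.logb_le_logb_of_le (b := 2) (by norm_num) (by positivity) h1
  rw [Real.logb_mul (by positivity) (by positivity), Real.logb_mul (by positivity) (by positivity),
    Real.logb_pow, Real.logb_pow, Real.logb_self_eq_one (by norm_num), mul_one] at h2
  have h3 : Real.logb 2 ((2 ^ (n - k - (Nat.log 2 n + 2)) : ℕ) : ℝ)
      = ((n - k - (Nat.log 2 n + 2) : ℕ) : ℝ) := by
    push_cast
    rw [Real.logb_pow, Real.logb_self_eq_one (by norm_num), mul_one]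
  have h4 : ((n - k : ℕ) : ℝ) ≤ ((n - k - (Nat.log 2 n + 2) : ℕ) : ℝ) + (Nat.log 2 n + 2) := by
    have : n - k ≤ (n - k - (Nat.log 2 n + 2)) + (Nat.log 2 n + 2) := by omega
    exact_mod_cast this
  have h5 : (Nat.log 2 n : ℝ) ≤ Real.logb 2 (n + 1) := by
    rw [Real.le_logb_iff_rpow_le (by norm_num) (by positivity), Real.rpow_natCast]
    have : 2 ^ Nat.log 2 n ≤ n := Nat.pow_log_le_self 2 (by omega)
    have : (2:ℝ) ^ Nat.log 2 n ≤ n := by exact_mod_cast this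
    linarith
  rw [h3, ge_iff_le, le_div_iff₀ hnpos]
  have h6 := mul_le_mul_of_nonneg_right hg hnpos.le
  nlinarith
end

section
/- For every ε > 0 there exists N such that for every n ≥ N there exists a three-write binary WOM code of length n whose rate is greater than 1.809 − ε. -/
/-- A three-write binary WOM code of length `n` over message sets `Ω1`, `Ω2`, `Ω3`:
each write only raises cells (coordinatewise `≤` with `false ≤ true`) and each round
can be decoded correctly, where the second-round conditions are required on all memory
states reachable from the first round, and the third-round conditions on all memory
states reachable from the second round. -/
def IsThreeWriteWOM (n : ℕ) {Ω1 Ω2 Ω3 : Type}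
    (E1 : Ω1 → (Fin n → Bool))
    (E2 : (Fin n → Bool) → Ω2 → (Fin n → Bool))
    (E3 : (Fin n → Bool) → Ω3 → (Fin n → Bool))
    (D1 : (Fin n → Bool) → Ω1) (D2 : (Fin n → Bool) → Ω2)
    (D3 : (Fin n → Bool) → Ω3) : Prop :=
  (∀ x1 : Ω1, D1 (E1 x1) = x1) ∧
  (∀ c ∈ Set.range E1, ∀ x2 : Ω2,
    (∀ i, c i ≤ E2 c x2 i) ∧ D2 (E2 c x2) = x2) ∧
  (∀ c ∈ {c' | ∃ (x1 : Ω1) (x2 : Ω2), E2 (E1 x1) x2 = c'}, ∀ x3 : Ω3,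
    (∀ i, c i ≤ E3 c x3 i) ∧ D3 (E3 c x3) = x3)

open Finset in
lemma wom_pick (x n : ℕ) : ∃ a ≤ n, (x+1)^n ≤ (n+1) * (n.choose a * x^(n-a)) := by
  by_contra! h
  have h1 : (x+1)^n = ∑ a ∈ range (n+1), n.choose a * x^(n-a) := by
    rw [add_comm, add_pow]
    refine sum_congr rfl fun a _ => ?_
    simp [mul_comm]
  have h2 : ∑ a ∈ range (n+1), (n+1) * (n.choose a * x^(n-a))
      < ∑ a ∈ range (n+1), (x+1)^n := by
    apply sum_lt_sum_of_nonempty (by simp)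
    intro a ha
    exact h a (by simpa [Nat.lt_succ_iff] using ha)
  rw [← mul_sum, ← h1] at h2
  simp at h2

open Finset in
lemma wom_color_count {X : Type} [Fintype X] [DecidableEq X] (C : Finset X) (S : X → Finset X)
    (K M : ℕ) (hM : 1 ≤ M) (hS : ∀ c ∈ C, (S c).card = K)
    (hlt : C.card * M * (M-1)^K < M^K) :
    ∃ f : X → Fin M, ∀ c ∈ C, ∀ m, ∃ y ∈ S c, f y = m := by
  by_contra! h
  let B : X × Fin M → Finset (X → Fin M) := fun p =>
    Fintype.piFinset (fun x => if x ∈ S p.1 then univ.erase p.2 else univ)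
  have hB : ∀ p ∈ C ×ˢ (univ : Finset (Fin M)),
      (B p).card ≤ (M-1)^K * M^(Fintype.card X - K) := by
    intro p hp
    have hc : (S p.1).card = K := hS _ (by simpa using hp)
    apply le_of_eq
    simp only [B, Fintype.card_piFinset]
    have : ∀ x, (if x ∈ S p.1 then (univ : Finset (Fin M)).erase p.2 else univ).card
        = if x ∈ S p.1 then M - 1 else M := by
      intro x; split_ifs <;> simp
    simp only [this]
    rw [prod_ite]
    simp only [prod_const]
    have e1 : (univ.filter (fun x => x ∈ S p.1)) = S p.1 := by ext; simp
    have e2 : (univ.filter (fun x => x ∉ S p.1)) = (S p.1)ᶜ := by ext; simp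
    rw [e1, e2, card_compl, hc]
  have hcov : (univ : Finset (X → Fin M)) ⊆ (C ×ˢ (univ : Finset (Fin M))).biUnion B := by
    intro f _
    obtain ⟨c, hc, m, hm⟩ := h f
    simp only [mem_biUnion]
    refine ⟨(c, m), by simp [hc], ?_⟩
    simp only [B, Fintype.mem_piFinset]
    intro x
    split_ifs with hx
    · simpa using hm x hx
    · simp
  have h1 := card_le_card hcov
  have h2 := card_biUnion_le_card_mul _ _ _ hB
  have h3 := h1.trans h2
  simp only [card_univ, Fintype.card_fun, Fintype.card_fin, card_product] at h3
  have hCne : C.Nonempty := by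
    obtain ⟨c, hc, _⟩ := h (fun _ => ⟨0, hM⟩)
    exact ⟨c, hc⟩
  obtain ⟨c, hc⟩ := hCne
  have hK : K ≤ Fintype.card X := by rw [← hS c hc]; exact card_le_univ _
  have h4 : M ^ Fintype.card X = M^K * M^(Fintype.card X - K) := by
    rw [← pow_add]; congr 1; omega
  have h5 : 0 < M^(Fintype.card X - K) := by positivity
  have := Nat.mul_lt_mul_of_pos_right hlt h5
  rw [h4] at h3
  nlinarith

lemma wom_ineq (n K M c : ℕ) (hM : 1 ≤ M) (hn : 1 ≤ n) (hc : c ≤ 2^n) (hM2 : M ≤ 2^n)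
    (hK : 2 * n * M ≤ K) : c * M * (M-1)^K < M^K := by
  have hM0 : (0:ℝ) < M := by exact_mod_cast hM
  have a1 : ((M - 1 : ℕ) : ℝ) = M * (1 - 1 / M) := by
    rw [Nat.cast_sub hM]; field_simp; simp
  have a2 : (1 - 1 / (M:ℝ)) ≤ Real.exp (-(1/M)) := by
    have := Real.add_one_le_exp (-(1/(M:ℝ))); linarith
  have a20 : 0 ≤ (1 - 1 / (M:ℝ)) := by
    have : 1/(M:ℝ) ≤ 1 := by rw [div_le_one hM0]; exact_mod_cast hM
    linarith
  have a3 : (1 - 1 / (M:ℝ))^K ≤ Real.exp (-(2*n)) := by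
    calc (1 - 1 / (M:ℝ))^K ≤ (Real.exp (-(1/M)))^K := pow_le_pow_left₀ a20 a2 K
      _ = Real.exp (K * (-(1/M))) := by rw [← Real.exp_nat_mul]
      _ ≤ _ := by
        apply Real.exp_le_exp.2
        have : (2 * n * M : ℝ) ≤ K := by exact_mod_cast hK
        have : (2 * n : ℝ) ≤ K / M := by rw [le_div_iff₀ hM0]; exact this
        have e : (K:ℝ) * (-(1/M)) = -(K/M) := by ring
        rw [e]; linarith
  have a4 : (c * M : ℝ) * Real.exp (-(2*n)) < 1 := by
    have h1 : (c * M : ℝ) ≤ 2^n * 2^n := by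
      have := Nat.mul_le_mul hc hM2
      exact_mod_cast this
    have h2 : (2:ℝ)^n * 2^n < Real.exp (2*n) := by
      have : (2:ℝ)^n < (Real.exp 1)^n :=
        pow_lt_pow_left₀ (by have := Real.exp_one_gt_d9; linarith) (by norm_num) (by omega)
      have e : Real.exp (2*n) = (Real.exp 1)^n * (Real.exp 1)^n := by
        rw [← Real.exp_nat_mul, ← Real.exp_add]; congr 1; ring
      rw [e]
      exact mul_lt_mul'' this this (by positivity) (by positivity)
    rw [Real.exp_neg, ← div_eq_mul_inv, div_lt_one (Real.exp_pos _)]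
    linarith
  have a5 : ((c * M * (M-1)^K : ℕ) : ℝ) < ((M^K : ℕ) : ℝ) := by
    push_cast [a1]
    rw [mul_pow]
    have h6 : (c * M : ℝ) * (1 - 1 / (M:ℝ))^K < 1 :=
      lt_of_le_of_lt (mul_le_mul_of_nonneg_left a3 (by positivity)) a4
    have h7 : (0:ℝ) < (M:ℝ)^K := by positivity
    nlinarith
  exact_mod_cast a5

open Finset in
lemma wom_color {n : ℕ} (hn : 1 ≤ n) (C : Finset (Finset (Fin n)))
    (S : Finset (Fin n) → Finset (Finset (Fin n)))
    (K : ℕ) (hK1 : 1 ≤ K) (hK2 : K ≤ 2^n) (hS : ∀ c ∈ C, (S c).card = K) :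
    ∃ M : ℕ, 1 ≤ M ∧ K ≤ 4 * n * M ∧
      ∃ f : Finset (Fin n) → Fin M, ∀ c ∈ C, ∀ m, ∃ y ∈ S c, f y = m := by
  by_cases h : K < 2 * n
  · refine ⟨1, le_rfl, by omega, fun _ => 0, fun c hc m => ?_⟩
    obtain ⟨y, hy⟩ : (S c).Nonempty := by
      rw [← card_pos, hS c hc]; omega
    exact ⟨y, hy, Subsingleton.elim _ _⟩
  · push Not at h
    have h0 : 0 < 2 * n := by omega
    have hM : 1 ≤ K / (2*n) := (Nat.one_le_div_iff h0).2 h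
    have hlt := Nat.lt_mul_div_succ K h0
    refine ⟨K / (2*n), hM, by nlinarith, ?_⟩
    apply wom_color_count C S K _ hM hS
    apply wom_ineq n K _ _ hM hn
    · have := card_le_univ C
      simpa using this
    · exact (Nat.div_le_self _ _).trans hK2
    · exact Nat.mul_div_le _ _

open Finset in
lemma wom_up_inj {n : ℕ} (a : Finset (Fin n)) (T : Finset (Finset (Fin n)))
    (hT : ∀ t ∈ T, t ⊆ aᶜ) : (T.image (fun t => a ∪ t)).card = T.card := by
  apply card_image_of_injOn
  intro s hs t ht hst
  have h1 := hT s hs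
  have h2 := hT t ht
  ext i
  have h3 := Finset.ext_iff.1 hst i
  have h4 := @h1 i
  have h5 := @h2 i
  simp only [mem_union, mem_compl] at h3 h4 h5
  tauto

/-- A three-write code whose three message sets multiply to nearly `4 ^ n`. -/
lemma wom_exists (n : ℕ) (hn : 1 ≤ n) :
    ∃ (M1 M2 M3 : ℕ), 0 < M1 ∧ 0 < M2 ∧ 0 < M3 ∧
      4^n ≤ (n+1)^2 * (4*n)^2 * (M1 * M2 * M3) ∧
      ∃ (E1 : Fin M1 → (Fin n → Bool))
        (E2 : (Fin n → Bool) → Fin M2 → (Fin n → Bool))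
        (E3 : (Fin n → Bool) → Fin M3 → (Fin n → Bool))
        (D1 : (Fin n → Bool) → Fin M1) (D2 : (Fin n → Bool) → Fin M2)
        (D3 : (Fin n → Bool) → Fin M3),
        IsThreeWriteWOM n E1 E2 E3 D1 D2 D3 := by
  classical
  obtain ⟨a, ha, h4⟩ := wom_pick 3 n
  obtain ⟨b, hb, h3⟩ := wom_pick 2 (n - a)
  obtain ⟨M2, hM2, hK2, f2, hf2⟩ := wom_color hn (Finset.powersetCard a Finset.univ)
    (fun s => (Finset.powersetCard b sᶜ).image (fun t => s ∪ t)) ((n-a).choose b)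
    (Nat.choose_pos hb)
    ((Nat.choose_le_two_pow _ _).trans (Nat.pow_le_pow_right (by norm_num) (by omega)))
    (by
      intro s hs
      rw [wom_up_inj _ _ (fun t ht => (Finset.mem_powersetCard.1 ht).1)]
      rw [Finset.card_powersetCard, Finset.card_compl, (Finset.mem_powersetCard.1 hs).2]
      simp)
  obtain ⟨M3, hM3, hK3, f3, hf3⟩ := wom_color hn (Finset.powersetCard (a+b) Finset.univ)
    (fun s => (Finset.powerset sᶜ).image (fun t => s ∪ t)) (2^(n-a-b))
    (Nat.one_le_two_pow) (Nat.pow_le_pow_right (by norm_num) (by omega))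
    (by
      intro s hs
      rw [wom_up_inj _ _ (fun t ht => (Finset.mem_powerset.1 ht))]
      rw [Finset.card_powerset, Finset.card_compl, (Finset.mem_powersetCard.1 hs).2]
      simp [Nat.sub_sub])
  have g2 : ∀ s m, ∃ y, s.card = a → (s ⊆ y ∧ y.card = a + b ∧ f2 y = m) := by
    intro s m
    by_cases hs : s.card = a
    · obtain ⟨y, hy, hym⟩ := hf2 s (by simp [Finset.mem_powersetCard, hs]) m
      refine ⟨y, fun _ => ?_⟩
      simp only [Finset.mem_image, Finset.mem_powersetCard] at hy
      obtain ⟨t, ⟨ht, htb⟩, rfl⟩ := hy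
      refine ⟨Finset.subset_union_left, ?_, hym⟩
      rw [Finset.card_union_of_disjoint, hs, htb]
      exact Finset.disjoint_left.2 fun i hi hit => by simpa [hi] using ht hit
    · exact ⟨s, fun h => absurd h hs⟩
  have g3 : ∀ s m, ∃ y, s.card = a + b → (s ⊆ y ∧ f3 y = m) := by
    intro s m
    by_cases hs : s.card = a + b
    · obtain ⟨y, hy, hym⟩ := hf3 s (by simp [Finset.mem_powersetCard, hs]) m
      refine ⟨y, fun _ => ?_⟩
      simp only [Finset.mem_image] at hy
      obtain ⟨t, ht, rfl⟩ := hy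
      exact ⟨Finset.subset_union_left, hym⟩
    · exact ⟨s, fun h => absurd h hs⟩
  choose G2 hG2 using g2
  choose G3 hG3 using g3
  let u : Finset (Fin n) → (Fin n → Bool) := fun s i => decide (i ∈ s)
  let v : (Fin n → Bool) → Finset (Fin n) := fun c => Finset.univ.filter (fun i => c i = true)
  have vu : ∀ s, v (u s) = s := by intro s; ext i; simp [u, v]
  have uinj : Function.Injective u := Function.LeftInverse.injective vu
  have umono : ∀ s t, s ⊆ t → ∀ i, u s i ≤ u t i := by
    intro s t hst i
    by_cases hi : i ∈ s
    · simp [u, hi, hst hi]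
    · simp [u, hi]
  have hM1 : 0 < n.choose a := Nat.choose_pos ha
  have hcard : (Finset.powersetCard a (Finset.univ : Finset (Fin n))).card = n.choose a := by simp
  let e := (Finset.equivFinOfCardEq hcard).symm
  let E1 : Fin (n.choose a) → (Fin n → Bool) := fun m => u (e m).1
  have E1inj : Function.Injective E1 :=
    uinj.comp (Subtype.val_injective.comp e.injective)
  have ecard : ∀ m, (e m).1.card = a := fun m => (Finset.mem_powersetCard.1 (e m).2).2
  haveI : Nonempty (Fin (n.choose a)) := ⟨⟨0, hM1⟩⟩
  refine ⟨n.choose a, M2, M3, hM1, hM2, hM3, ?_, E1, fun c m => u (G2 (v c) m),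
    fun c m => u (G3 (v c) m), Function.invFun E1, fun c => f2 (v c), fun c => f3 (v c), ?_, ?_, ?_⟩
  · have h3' : 3^(n-a) ≤ (n+1) * ((4*n*M2) * (4*n*M3)) := by
      refine h3.trans ?_
      exact Nat.mul_le_mul (by omega) (Nat.mul_le_mul hK2 hK3)
    calc 4^n ≤ (n+1) * (n.choose a * 3^(n-a)) := h4
      _ ≤ (n+1) * (n.choose a * ((n+1) * ((4*n*M2) * (4*n*M3)))) := by gcongr
      _ = _ := by ring
  · exact fun m => Function.leftInverse_invFun E1inj m
  · rintro _ ⟨x1, rfl⟩ x2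
    have h := hG2 (e x1).1 x2 (ecard x1)
    simp only [E1, vu]
    exact ⟨umono _ _ h.1, h.2.2⟩
  · rintro _ ⟨x1, x2, rfl⟩ x3
    have h := hG2 (e x1).1 x2 (ecard x1)
    have h' := hG3 _ x3 h.2.1
    simp only [E1, vu]
    exact ⟨umono _ _ h'.1, h'.2⟩

lemma wom_poly : ∃ N : ℕ, ∀ n : ℕ, N ≤ n →
    Real.logb 2 (((n:ℝ)+1)^2 * (4*n)^2) < 0.19 * n := by
  have h1 : (fun x : ℝ => Real.log x) =o[Filter.atTop] (fun x : ℝ => x) := Real.isLittleO_log_id_atTop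
  have h2 := (h1.bound (c := 1/80) (by norm_num)).and (Filter.eventually_ge_atTop (1000:ℝ))
  have h3 := (tendsto_natCast_atTop_atTop (R := ℝ)).eventually h2
  obtain ⟨N, hN⟩ := Filter.eventually_atTop.1 h3
  refine ⟨N, fun n hn => ?_⟩
  obtain ⟨hb, hl⟩ := hN n hn
  have hn0 : (0:ℝ) < n := by linarith
  have hb : Real.log n ≤ 1/80 * n := by
    refine (le_abs_self _).trans ?_
    simpa [abs_of_pos hn0] using hb
  have hle : ((n:ℝ)+1)^2 * (4*n)^2 ≤ (n:ℝ)^5 := by nlinarith [pow_pos hn0 4, pow_pos hn0 3, pow_pos hn0 2]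
  have hlog : Real.log (((n:ℝ)+1)^2 * (4*n)^2) ≤ 5 * Real.log n := by
    refine (Real.log_le_log (by positivity) hle).trans ?_
    rw [Real.log_pow]; norm_num
  have := Real.log_two_gt_d9
  rw [Real.logb, div_lt_iff₀ (by linarith)]
  nlinarith

/-- For every `ε > 0` there exists `N` such that for every `n ≥ N` there
exists a three-write binary WOM code of length `n` whose rate
`(log₂|Ω1| + log₂|Ω2| + log₂|Ω3|)/n` is greater than `1.809 - ε`. -/
theorem three_write_WOM_rate (ε : ℝ) (hε : 0 < ε) :
    ∃ N : ℕ, ∀ n : ℕ, N ≤ n →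
      ∃ (Ω1 Ω2 Ω3 : Type) (i1 : Fintype Ω1) (i2 : Fintype Ω2) (i3 : Fintype Ω3)
        (E1 : Ω1 → (Fin n → Bool))
        (E2 : (Fin n → Bool) → Ω2 → (Fin n → Bool))
        (E3 : (Fin n → Bool) → Ω3 → (Fin n → Bool))
        (D1 : (Fin n → Bool) → Ω1) (D2 : (Fin n → Bool) → Ω2)
        (D3 : (Fin n → Bool) → Ω3),
        IsThreeWriteWOM n E1 E2 E3 D1 D2 D3 ∧
        (Real.logb 2 (@Fintype.card Ω1 i1) + Real.logb 2 (@Fintype.card Ω2 i2)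
            + Real.logb 2 (@Fintype.card Ω3 i3)) / n
          > 1.809 - ε := by
  obtain ⟨N, hN⟩ := wom_poly
  refine ⟨N + 1, fun n hn => ?_⟩
  have hn1 : 1 ≤ n := by omega
  obtain ⟨M1, M2, M3, h1, h2, h3, hle, E1, E2, E3, D1, D2, D3, hW⟩ := wom_exists n hn1
  refine ⟨Fin M1, Fin M2, Fin M3, inferInstance, inferInstance, inferInstance,
    E1, E2, E3, D1, D2, D3, hW, ?_⟩
  simp only [Fintype.card_fin]
  have hp := hN n (by omega)
  have r0 : (0:ℝ) < n := by exact_mod_cast hn1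
  have r1 : (0:ℝ) < M1 := by exact_mod_cast h1
  have r2 : (0:ℝ) < M2 := by exact_mod_cast h2
  have r3 : (0:ℝ) < M3 := by exact_mod_cast h3
  have hle' : (4:ℝ)^n ≤ (((n:ℝ)+1)^2 * (4*n)^2) * (M1 * M2 * M3) := by exact_mod_cast hle
  have hlog := Real.logb_le_logb_of_le (b := 2) (by norm_num) (by positivity) hle'
  rw [Real.logb_mul (by positivity) (by positivity), Real.logb_mul (x := M1 * M2) (by positivity) (by positivity),
    Real.logb_mul (x := M1) (by positivity) (by positivity), Real.logb_pow] at hlog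
  have l4 : Real.logb 2 4 = 2 := by
    rw [show (4:ℝ) = 2^(2:ℕ) by norm_num, Real.logb_pow]; simp
  rw [l4] at hlog
  rw [gt_iff_lt, lt_div_iff₀ r0]
  nlinarith
end

section
/- Let m ≥ 1 be an integer and let w1, w2 : {1,…,4m} → {0,1,2,3} be functions each taking the value 0 on exactly m indices. Let c : {1,…,4m} → ℕ satisfy: c(i) ≤ 3 for every i; if c(i) = 3 then w1(i) ≠ 0 and w2(i) = 0; and if w1(i) = 0 then c(i) ≤ 1. Then Σ_{i=1}^{4m} c(i) ≤ 8m. -/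
/-- Let `m ≥ 1` and let `w1, w2 : {1,…,4m} → {0,1,2,3}` each take the
value `0` on exactly `m` indices. Let `c : {1,…,4m} → ℕ` (the weight of each triplet of
cells after the second write) satisfy: `c i ≤ 3` for all `i`; if `c i = 3` then
`w1 i ≠ 0` and `w2 i = 0`; and if `w1 i = 0` then `c i ≤ 1`. Then `∑ i, c i ≤ 8m`. -/
theorem weight_after_second_write (m : ℕ) (hm : 1 ≤ m)
    (w1 w2 : Fin (4 * m) → Fin 4)
    (h1 : (Finset.univ.filter fun i => w1 i = 0).card = m)
    (h2 : (Finset.univ.filter fun i => w2 i = 0).card = m)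
    (c : Fin (4 * m) → ℕ)
    (hc : ∀ i, c i ≤ 3)
    (hc3 : ∀ i, c i = 3 → w1 i ≠ 0 ∧ w2 i = 0)
    (hc0 : ∀ i, w1 i = 0 → c i ≤ 1) :
    ∑ i, c i ≤ 8 * m := by
  have key : ∑ i, (c i + if w1 i = 0 then 1 else 0) ≤ ∑ i, (2 + if w2 i = 0 then 1 else 0) := by
    apply Finset.sum_le_sum
    intro i _
    have a := hc i
    have b := hc3 i
    have d := hc0 i
    by_cases e : w1 i = 0
    · have := d e
      rw [if_pos e]
      omega
    · rw [if_neg e]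
      by_cases f : w2 i = 0
      · rw [if_pos f]
        omega
      · rw [if_neg f]
        have : c i ≠ 3 := fun h => f (b h).2
        omega
  rw [Finset.sum_add_distrib, Finset.sum_add_distrib, ← Finset.card_filter,
    ← Finset.card_filter, h1, h2, Finset.sum_const, Finset.card_univ, Fintype.card_fin,
    smul_eq_mul] at key
  omega
end

section
/- Let m ≥ 1 be an integer and p ∈ [0,1] a real number. Let ι be a finite set with |ι| = 4m, let w1 : ι → {0,1,2,3} with |{i : w1(i) ≠ 0}| ≤ 4(1−p)m, and let c : ι → ℕ satisfy: c(i) ≤ 3 for all i; |{i : w1(i) ≠ 0 and c(i) = 3}| ≤ (1−p)m; |{i : w1(i) ≠ 0 and c(i) ≤ 1}| ≥ (1−p)m; c(i) ≤ 1 whenever w1(i) = 0; and |{i : w1(i) = 0 and c(i) = 0}| ≥ pm. Then Σ_{i∈ι} c(i) ≤ (8 − 5p)·m. -/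
/-- The counting argument bounding the total Hamming weight after the
second write in Improvement III of the 3-write WOM construction. Let `m ≥ 1`,
`p ∈ [0,1]`, let `ι` be a finite set of size `4m`, `w1 : ι → {0,1,2,3}` with at most
`4(1-p)m` nonzero values, and `c : ι → ℕ` with: `c i ≤ 3` for all `i`; at most `(1-p)m`
indices with `w1 i ≠ 0` have `c i = 3`; at least `(1-p)m` indices with `w1 i ≠ 0` have
`c i ≤ 1`; `c i ≤ 1` whenever `w1 i = 0`; and at least `pm` indices with `w1 i = 0`
have `c i = 0`. Then `∑ i, c i ≤ (8 - 5p)·m`. -/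
theorem weight_after_second_write_improved (m : ℕ) (hm : 1 ≤ m)
    (p : ℝ) (hp0 : 0 ≤ p) (hp1 : p ≤ 1)
    (ι : Type) [Fintype ι] (hι : Fintype.card ι = 4 * m)
    (w1 : ι → Fin 4)
    (hw1 : ((Finset.univ.filter fun i => w1 i ≠ 0).card : ℝ) ≤ 4 * (1 - p) * m)
    (c : ι → ℕ)
    (hc : ∀ i, c i ≤ 3)
    (h3 : ((Finset.univ.filter fun i => w1 i ≠ 0 ∧ c i = 3).card : ℝ) ≤ (1 - p) * m)
    (h1 : ((1 - p) * m : ℝ) ≤ (Finset.univ.filter fun i => w1 i ≠ 0 ∧ c i ≤ 1).card)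
    (hz : ∀ i, w1 i = 0 → c i ≤ 1)
    (hz0 : ((p * m : ℝ)) ≤ (Finset.univ.filter fun i => w1 i = 0 ∧ c i = 0).card) :
    ((∑ i, c i : ℕ) : ℝ) ≤ (8 - 5 * p) * m := by
  have key : (∑ i, c i) + (Finset.univ.filter fun i => w1 i ≠ 0 ∧ c i ≤ 1).card
      + (Finset.univ.filter fun i => w1 i = 0 ∧ c i = 0).card
      ≤ 4 * m + (Finset.univ.filter fun i => w1 i ≠ 0).card
      + (Finset.univ.filter fun i => w1 i ≠ 0 ∧ c i = 3).card := by
    rw [← hι, ← Finset.card_univ, Finset.card_eq_sum_ones Finset.univ]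
    simp only [Finset.card_filter]
    simp only [← Finset.sum_add_distrib]
    apply Finset.sum_le_sum
    intro i _
    have a := hc i
    have b := hz i
    by_cases h : w1 i = 0
    · have b := b h
      simp only [h, ne_eq, not_true_eq_false, false_and, true_and, if_false]
      split_ifs <;> omega
    · simp only [h, ne_eq, not_false_eq_true, false_and, true_and, if_false, if_true]
      split_ifs <;> omega
  have key' := (Nat.cast_le (α := ℝ)).mpr key
  rw [Nat.cast_add, Nat.cast_add, Nat.cast_add, Nat.cast_add, Nat.cast_mul] at key'
  norm_num only [Nat.cast_ofNat] at key'
  linarith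
end

section
/- There exists a two-write binary WOM code of length 3 with message sets Ω1 and Ω2 satisfying |Ω1| = |Ω2| = 4; that is, there exist E1 : {0,1,2,3} → {0,1}^3 and E2 : E1({0,1,2,3}) × {0,1,2,3} → {0,1}^3 and decoding functions D1, D2 such that D1(E1(x)) = x, E1(x1) ≤ E2(E1(x1), x2) coordinatewise, and D2(E2(E1(x1), x2)) = x2 for all x1, x2 ∈ {0,1,2,3}. Such a code has rate 4/3. -/
/-- There exists a two-write binary WOM code of length `3` with message
sets `Ω1 = Ω2 = {0,1,2,3}` of size `4` each (the Rivest–Shamir code); such a code has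
rate `(log₂ 4 + log₂ 4)/3 = 4/3`. -/
theorem rivest_shamir_code :
    (∃ (E1 : Fin 4 → (Fin 3 → Bool)) (E2 : (Fin 3 → Bool) → Fin 4 → (Fin 3 → Bool))
       (D1 : (Fin 3 → Bool) → Fin 4) (D2 : (Fin 3 → Bool) → Fin 4),
       IsTwoWriteWOM 3 E1 E2 D1 D2) ∧
    (Real.logb 2 (Fintype.card (Fin 4)) + Real.logb 2 (Fintype.card (Fin 4))) / 3
      = 4 / 3 := by
  refine ⟨?_, ?_⟩
  · -- first-round codewords 000, 001, 010, 100
    let E : Fin 4 → (Fin 3 → Bool) :=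
      ![![false, false, false], ![false, false, true], ![false, true, false],
        ![true, false, false]]
    -- a word is decoded to the symbol whose codeword, or whose complemented codeword, it is
    let D : (Fin 3 → Bool) → Fin 4 := fun w =>
      bif w 0 == w 1 then (bif w 1 == w 2 then 0 else 1)
      else (bif w 0 == w 2 then 2 else 3)
    refine ⟨E, fun w x => if D w = x then w else fun i => !(E x i), D, D, ?_, ?_, ?_⟩
    · decide
    · decide
    · decide
  · have h : Real.logb 2 4 = 2 := by
      rw [show (4 : ℝ) = 2 ^ (2 : ℝ) by norm_num]
      exact Real.logb_rpow (by norm_num) (by norm_num)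
    simp only [Fintype.card_fin, Nat.cast_ofNat, h]
    norm_num
end
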